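/- A distributivity matrix is normal if and only if all its maximal branches are towers. -/

import Mathlib

/-- `b ⊆* a`: `b \ a` is finite. -/
def AlmostSubset (b a : Set ℕ) : Prop := (b \ a).Finite

/-- A mad family on ℕ: a maximal almost disjoint family of infinite subsets of ℕ. -/
def IsMadFamily (A : Set (Set ℕ)) : Prop :=
  (∀ a ∈ A, a.Infinite) ∧
  (A.Pairwise fun a a' => (a ∩ a').Finite) ∧
  (∀ b : Set ℕ, b.Infinite → ∃ a ∈ A, (b ∩ a).Infinite)

/-- `B` refines `A`: every element of `B` is almost included in some element of `A`. -/
def Refines (B A : Set (Set ℕ)) : Prop := ∀ b ∈ B, ∃ a ∈ A, AlmostSubset b a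

/-- A distributivity matrix of height `lam`: a refining system of mad families
indexed by the ordinals below `lam`, without common (mad) refinement. -/
def IsDistribMatrix (lam : Ordinal) (A : Ordinal → Set (Set ℕ)) : Prop :=
  (∀ ξ < lam, IsMadFamily (A ξ)) ∧
  (∀ ξ η : Ordinal, ξ ≤ η → η < lam → Refines (A η) (A ξ)) ∧
  ¬ ∃ B : Set (Set ℕ), IsMadFamily B ∧ ∀ ξ < lam, Refines B (A ξ)


/-- A tower of length `δ`: a `⊆*`-decreasing sequence of infinite subsets of ℕ
indexed by the ordinals below `δ`, with no infinite pseudo-intersection. -/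
def IsTower (δ : Ordinal) (a : Ordinal → Set ℕ) : Prop :=
  (∀ ξ < δ, (a ξ).Infinite) ∧
  (∀ ξ η : Ordinal, ξ ≤ η → η < δ → AlmostSubset (a η) (a ξ)) ∧
  ¬ ∃ b : Set ℕ, b.Infinite ∧ ∀ ξ < δ, AlmostSubset b (a ξ)

/-- A branch of length `δ ≤ lam` through the matrix `{A ξ : ξ < lam}`:
a `⊆*`-decreasing sequence with `a ξ ∈ A ξ` for all `ξ < δ`. -/
def IsBranch (lam : Ordinal) (A : Ordinal → Set (Set ℕ))
    (δ : Ordinal) (a : Ordinal → Set ℕ) : Prop :=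
  δ ≤ lam ∧ (∀ ξ < δ, a ξ ∈ A ξ) ∧
  ∀ ξ η : Ordinal, ξ ≤ η → η < δ → AlmostSubset (a η) (a ξ)

/-- A maximal branch: a branch which no strictly longer branch extends. -/
def IsMaximalBranch (lam : Ordinal) (A : Ordinal → Set (Set ℕ))
    (δ : Ordinal) (a : Ordinal → Set ℕ) : Prop :=
  IsBranch lam A δ a ∧
  ¬ ∃ (δ' : Ordinal) (a' : Ordinal → Set ℕ), δ < δ' ∧ IsBranch lam A δ' a' ∧
    ∀ ξ < δ, a' ξ = a ξ

/-- `b` intersects the matrix `{A ξ : ξ < lam}`: for each `ξ < lam` there is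
`a ∈ A ξ` with `b ⊆* a`. -/
def Intersects (lam : Ordinal) (A : Ordinal → Set (Set ℕ)) (b : Set ℕ) : Prop :=
  ∀ ξ < lam, ∃ a ∈ A ξ, AlmostSubset b a

theorem AlmostSubset.trans {a b c : Set ℕ} (hab : AlmostSubset a b) (hbc : AlmostSubset b c) :
    AlmostSubset a c :=
  (Set.Finite.union hab hbc).subset fun x hx => by
    by_cases hxb : x ∈ b
    · exact Or.inr ⟨hxb, hx.2⟩
    · exact Or.inl ⟨hx.1, hxb⟩

theorem Set.Subset.almostSubset {a b : Set ℕ} (h : a ⊆ b) : AlmostSubset a b := by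
  simp [AlmostSubset, Set.sdiff_eq_empty.2 h]

/-- Two members of a mad family almost containing a common infinite set are equal. -/
theorem IsMadFamily.eq_of_almostSubset {A : Set (Set ℕ)} (hA : IsMadFamily A) {a a' b : Set ℕ}
    (ha : a ∈ A) (ha' : a' ∈ A) (hb : b.Infinite) (hba : AlmostSubset b a)
    (hba' : AlmostSubset b a') : a = a' := by
  by_contra hne
  refine hb (((Set.Finite.union hba hba').union (hA.2.1 ha ha' hne)).subset fun x hx => ?_)
  by_cases hxa : x ∈ a
  · by_cases hxa' : x ∈ a'
    · exact Or.inr ⟨hxa, hxa'⟩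
    · exact Or.inl (Or.inr ⟨hx, hxa'⟩)
  · exact Or.inl (Or.inl ⟨hx, hxa⟩)

/-- If an infinite set is almost contained in `c ∈ B` and in `a ∈ A`, where `B` refines the mad
family `A`, then `c` is almost contained in `a`. -/
theorem Refines.almostSubset_of_common {A B : Set (Set ℕ)} (hBA : Refines B A)
    (hA : IsMadFamily A) {a b c : Set ℕ} (ha : a ∈ A) (hc : c ∈ B) (hb : b.Infinite)
    (hba : AlmostSubset b a) (hbc : AlmostSubset b c) : AlmostSubset c a := by
  obtain ⟨a', ha', hca'⟩ := hBA c hc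
  rwa [hA.eq_of_almostSubset ha ha' hb hba (hbc.trans hca')]

/-- A branch of length `δ < lam` with an infinite pseudo-intersection extends to length `δ + 1`. -/
theorem IsBranch.exists_extension {lam : Ordinal} {A : Ordinal → Set (Set ℕ)}
    (hmat : IsDistribMatrix lam A) {δ : Ordinal} {a : Ordinal → Set ℕ} (h : IsBranch lam A δ a)
    (hδ : δ < lam) {b : Set ℕ} (hb : b.Infinite) (hba : ∀ ξ < δ, AlmostSubset b (a ξ)) :
    ∃ a' : Ordinal → Set ℕ, IsBranch lam A (Order.succ δ) a' ∧ ∀ ξ < δ, a' ξ = a ξ := by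
  obtain ⟨c, hc, hbc⟩ := (hmat.1 δ hδ).2.2 b hb
  have hca : ∀ ξ < δ, AlmostSubset c (a ξ) := fun ξ hξ =>
    (hmat.2.1 ξ δ hξ.le hδ).almostSubset_of_common (hmat.1 ξ (hξ.trans hδ)) (h.2.1 ξ hξ) hc hbc
      (Set.inter_subset_left.almostSubset.trans (hba ξ hξ)) Set.inter_subset_right.almostSubset
  refine ⟨fun ξ => if ξ < δ then a ξ else c, ⟨Order.succ_le_of_lt hδ, fun ξ hξ => ?_,
    fun ξ η hξη hη => ?_⟩, fun ξ hξ => if_pos hξ⟩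
  · rcases (Order.lt_succ_iff.1 hξ).lt_or_eq with hlt | rfl
    · simpa [hlt] using h.2.1 ξ hlt
    · simpa using hc
  · by_cases hηδ : η < δ
    · simpa [hηδ, hξη.trans_lt hηδ] using h.2.2 ξ η hξη hηδ
    · by_cases hξδ : ξ < δ
      · simpa [hηδ, hξδ] using hca ξ hξδ
      · simpa [hηδ, hξδ] using (subset_refl c).almostSubset

/-- A set intersecting the matrix is a pseudo-intersection of a branch of full length. -/
theorem Intersects.exists_branch {lam : Ordinal} {A : Ordinal → Set (Set ℕ)}
    (hmat : IsDistribMatrix lam A) {b : Set ℕ} (hb : b.Infinite) (h : Intersects lam A b) :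
    ∃ a : Ordinal → Set ℕ, IsBranch lam A lam a ∧ ∀ ξ < lam, AlmostSubset b (a ξ) := by
  choose! a ha hba using h
  exact ⟨a, ⟨le_rfl, ha, fun ξ η hξη hη =>
    (hmat.2.1 ξ η hξη hη).almostSubset_of_common (hmat.1 ξ (hξη.trans_lt hη))
      (ha ξ (hξη.trans_lt hη)) (ha η hη) hb (hba ξ (hξη.trans_lt hη)) (hba η hη)⟩, hba⟩

/-- A distributivity matrix is normal (no infinite set intersects it) iff all
its maximal branches are towers. -/
theorem normal_iff_maximal_branches_are_towers (lam : Ordinal)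
    (A : Ordinal → Set (Set ℕ)) (hmat : IsDistribMatrix lam A) :
    (∀ b : Set ℕ, b.Infinite → ¬ Intersects lam A b) ↔
      (∀ (δ : Ordinal) (a : Ordinal → Set ℕ),
        IsMaximalBranch lam A δ a → IsTower δ a) := by
  constructor
  · rintro hnormal δ a ⟨hbr, hmax⟩
    refine ⟨fun ξ hξ => (hmat.1 ξ (hξ.trans_le hbr.1)).1 _ (hbr.2.1 ξ hξ), hbr.2.2, ?_⟩
    rintro ⟨b, hb, hba⟩
    rcases hbr.1.lt_or_eq with hlt | rfl
    · obtain ⟨a', ha', heq⟩ := hbr.exists_extension hmat hlt hb hba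
      exact hmax ⟨_, a', Order.lt_succ δ, ha', heq⟩
    · exact hnormal b hb fun ξ hξ => ⟨a ξ, hbr.2.1 ξ hξ, hba ξ hξ⟩
  · intro htower b hb hint
    obtain ⟨a, ha, hba⟩ := hint.exists_branch hmat hb
    refine (htower lam a ⟨ha, ?_⟩).2.2 ⟨b, hb, hba⟩
    rintro ⟨δ', a', hlt, hbr, -⟩
    exact hlt.not_ge hbr.1
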